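/- A finitely complete category C is a pretopos if and only if C is diexact and has a strict initial object. -/

import Mathlib

open CategoryTheory CategoryTheory.Limits

universe v u

section Defs

variable {C : Type u} [Category.{v} C]

/-- A span `(f, g)` is *jointly monic* if `u ≫ f = v ≫ f` and `u ≫ g = v ≫ g` imply `u = v`
(equivalently, the induced map into the product is a monomorphism). -/
def JointlyMonic {Z A B : C} (f : Z ⟶ A) (g : Z ⟶ B) : Prop :=
  ∀ ⦃X : C⦄ (u v : X ⟶ Z), u ≫ f = v ≫ f → u ≫ g = v ≫ g → u = v

/-- `(P, π₁, π₂, π₃)` is the limit `C ×_B C ×_A C` of triples `(c₁, c₂, c₃)` of generalized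
elements of `Z` with `g ∘ π₁ = g ∘ π₂` and `f ∘ π₂ = f ∘ π₃`. -/
structure IsTripleLimit {Z A B : C} (f : Z ⟶ A) (g : Z ⟶ B) {P : C}
    (π₁ π₂ π₃ : P ⟶ Z) : Prop where
  w₁ : π₁ ≫ g = π₂ ≫ g
  w₂ : π₂ ≫ f = π₃ ≫ f
  lift : ∀ ⦃X : C⦄ (x₁ x₂ x₃ : X ⟶ Z), x₁ ≫ g = x₂ ≫ g → x₂ ≫ f = x₃ ≫ f →
    ∃! u : X ⟶ P, u ≫ π₁ = x₁ ∧ u ≫ π₂ = x₂ ∧ u ≫ π₃ = x₃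

/-- A jointly monic span `(f, g)` is a *Mal'cev span* if, for the limit
`P = C ×_B C ×_A C`, there exists `p : P ⟶ C` with `f ∘ p = f ∘ π₁` and `g ∘ p = g ∘ π₃`. -/
def IsMalcevSpan {Z A B : C} (f : Z ⟶ A) (g : Z ⟶ B) : Prop :=
  JointlyMonic f g ∧
  ∀ ⦃P : C⦄ (π₁ π₂ π₃ : P ⟶ Z), IsTripleLimit f g π₁ π₂ π₃ →
    ∃ p : P ⟶ Z, p ≫ f = π₁ ≫ f ∧ p ≫ g = π₃ ≫ g

/-- A commuting square (with legs `f, g` and colegs `h, k`) is *stable under pullback* if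
every commutative cube over it whose four side faces are pullbacks has a pushout top face. -/
def PushoutStable {Z A B D : C} (f : Z ⟶ A) (g : Z ⟶ B) (h : A ⟶ D) (k : B ⟶ D) : Prop :=
  ∀ ⦃Z' A' B' D' : C⦄ (f' : Z' ⟶ A') (g' : Z' ⟶ B') (h' : A' ⟶ D') (k' : B' ⟶ D')
    (αZ : Z' ⟶ Z) (αA : A' ⟶ A) (αB : B' ⟶ B) (αD : D' ⟶ D),
    IsPullback f' αZ αA f → IsPullback g' αZ αB g →
    IsPullback h' αA αD h → IsPullback k' αB αD k →
    f' ≫ h' = g' ≫ k' → IsPushout f' g' h' k'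

/-- A category is *diexact* if every Mal'cev span admits a pushout, and every pushout square
of a Mal'cev span is stable under pullback and is itself a pullback square. -/
def Diexact (C : Type u) [Category.{v} C] : Prop :=
  ∀ ⦃Z A B : C⦄ (f : Z ⟶ A) (g : Z ⟶ B), IsMalcevSpan f g →
    (∃ (D : C) (h : A ⟶ D) (k : B ⟶ D), IsPushout f g h k) ∧
    ∀ ⦃D : C⦄ (h : A ⟶ D) (k : B ⟶ D), IsPushout f g h k →
      PushoutStable f g h k ∧ IsPullback f g h k

/-- An internal equivalence relation: a jointly monic pair which is reflexive, symmetric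
and transitive. -/
def IsEquivRelation [HasPullbacks C] {E A : C} (s t : E ⟶ A) : Prop :=
  JointlyMonic s t ∧
  (∃ r : A ⟶ E, r ≫ s = 𝟙 A ∧ r ≫ t = 𝟙 A) ∧
  (∃ σ : E ⟶ E, σ ≫ s = t ∧ σ ≫ t = s) ∧
  (∃ τ : pullback t s ⟶ E,
     τ ≫ s = pullback.fst t s ≫ s ∧ τ ≫ t = pullback.snd t s ≫ t)

/-- A finitely complete category is *Barr-exact* if every kernel pair has a coequaliser,
regular epimorphisms are stable under pullback, and every internal equivalence relation is
effective (i.e. a kernel pair). -/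
def BarrExact (C : Type u) [Category.{v} C] [HasFiniteLimits C] : Prop :=
  (∀ ⦃X Y : C⦄ (f : X ⟶ Y), HasCoequalizer (pullback.fst f f) (pullback.snd f f)) ∧
  (∀ ⦃X Y W : C⦄ (f : X ⟶ Y) (g : W ⟶ Y),
     Nonempty (RegularEpi f) → Nonempty (RegularEpi (pullback.snd f g))) ∧
  (∀ ⦃E A : C⦄ (s t : E ⟶ A), IsEquivRelation s t →
     ∃ (Q : C) (q : A ⟶ Q), IsPullback s t q q)

/-- A category is *amalgamable* if every span of monomorphisms admits a pushout which is
stable under pullback and is itself a pullback square. -/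
def Amalgamable (C : Type u) [Category.{v} C] : Prop :=
  ∀ ⦃Z A B : C⦄ (f : Z ⟶ A) (g : Z ⟶ B), Mono f → Mono g →
    ∃ (D : C) (h : A ⟶ D) (k : B ⟶ D),
      IsPushout f g h k ∧ PushoutStable f g h k ∧ IsPullback f g h k

/-- A category is *adhesive* if it admits pushouts along monomorphisms, and these pushouts
are stable under pullback and are pullback squares. -/
def AdhesiveCat (C : Type u) [Category.{v} C] : Prop :=
  ∀ ⦃Z A B : C⦄ (f : Z ⟶ A) (g : Z ⟶ B), Mono f →
    (∃ (D : C) (h : A ⟶ D) (k : B ⟶ D), IsPushout f g h k) ∧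
    ∀ ⦃D : C⦄ (h : A ⟶ D) (k : B ⟶ D), IsPushout f g h k →
      PushoutStable f g h k ∧ IsPullback f g h k

/-- `u` factors through `v` (as morphisms into a common object `X`). -/
def FactorsThru {U V X : C} (u : U ⟶ X) (v : V ⟶ X) : Prop :=
  ∃ w : U ⟶ V, w ≫ v = u

/-- A monomorphism `m : P ⟶ X` is the *union* of the subobjects `a : A ⟶ X` and `b : B ⟶ X`:
both factor through `m`, and `m` factors through any monomorphism through which both factor. -/
def IsUnionOf {A B P X : C} (a : A ⟶ X) (b : B ⟶ X) (m : P ⟶ X) : Prop :=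
  Mono m ∧ FactorsThru a m ∧ FactorsThru b m ∧
  ∀ ⦃Q : C⦄ (c : Q ⟶ X), Mono c → FactorsThru a c → FactorsThru b c → FactorsThru m c

end Defs

section DiexactToPretopos

variable {C : Type u} [Category.{v} C]

lemma isMalcevSpan_of_isPullback {Z A B D : C} {f : Z ⟶ A} {g : Z ⟶ B} {h : A ⟶ D} {k : B ⟶ D}
    (sq : IsPullback f g h k) : IsMalcevSpan f g := by
  refine ⟨fun X u v hf hg => sq.hom_ext hf hg, fun P π₁ π₂ π₃ hP => ?_⟩
  obtain ⟨p, hp₁, hp₂⟩ := sq.exists_lift (π₁ ≫ f) (π₃ ≫ g) (by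
    rw [Category.assoc, sq.w, reassoc_of% hP.w₁, ← sq.w, reassoc_of% hP.w₂, sq.w, Category.assoc])
  exact ⟨p, hp₁, hp₂⟩

lemma IsEquivRelation.isMalcevSpan [HasPullbacks C] {E A : C} {s t : E ⟶ A}
    (h : IsEquivRelation s t) : IsMalcevSpan s t := by
  obtain ⟨hmono, -, ⟨σ, hσs, hσt⟩, τ, hτs, hτt⟩ := h
  have trans : ∀ {P : C} (x y : P ⟶ E), x ≫ t = y ≫ s → ∃ z : P ⟶ E, z ≫ s = x ≫ s ∧
      z ≫ t = y ≫ t := fun x y hxy =>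
    ⟨pullback.lift x y hxy ≫ τ, by simp [hτs, pullback.lift_fst_assoc],
      by simp [hτt, pullback.lift_snd_assoc]⟩
  refine ⟨hmono, fun P π₁ π₂ π₃ hP => ?_⟩
  obtain ⟨x, hxs, hxt⟩ := trans π₁ (π₂ ≫ σ) (by simp [hσs, hP.w₁])
  obtain ⟨y, hys, hyt⟩ := trans x π₃ (by simp [hxt, hσt, hP.w₂])
  exact ⟨y, hys.trans hxs, hyt⟩

lemma isPullback_of_isInitial [HasStrictInitialObjects C] {Z A B D : C} {f : Z ⟶ A} {g : Z ⟶ B}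
    {h : A ⟶ D} {k : B ⟶ D} (w : f ≫ h = g ≫ k) (hB : IsInitial B) : IsPullback f g h k := by
  have := hB.isIso_to g
  refine ⟨⟨w⟩, ⟨PullbackCone.IsLimit.mk w (fun s => s.snd ≫ inv g) (fun s => ?_) (fun s => ?_)
    (fun s m _ hm => ?_)⟩⟩
  · have := hB.isIso_to s.snd
    exact (hB.ofIso (asIso s.snd).symm).hom_ext _ _
  · simp
  · simp [← hm]

lemma nonempty_isColimit_binaryCofan_of_isPushout {A B D I : C} (hI : IsInitial I)
    {i : A ⟶ D} {j : B ⟶ D} (h : IsPushout (hI.to A) (hI.to B) i j) :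
    Nonempty (IsColimit (BinaryCofan.mk i j)) :=
  ⟨BinaryCofan.isColimitMk (fun s => h.desc s.inl s.inr (hI.hom_ext _ _))
    (fun _ => h.inl_desc _ _ _) (fun _ => h.inr_desc _ _ _)
    (fun _ _ h₁ h₂ => h.hom_ext (h₁.trans (h.inl_desc _ _ _).symm)
      (h₂.trans (h.inr_desc _ _ _).symm))⟩

lemma isMalcevSpan_initial [HasInitial C] [HasStrictInitialObjects C] (A B : C) :
    IsMalcevSpan (initial.to A) (initial.to B) := by
  refine ⟨fun X u v _ _ => initial.strict_hom_ext u v, fun P π₁ π₂ π₃ _ => ⟨π₁, rfl, ?_⟩⟩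
  rw [initial.strict_hom_ext π₁ π₃]

namespace Diexact

section Coproducts

variable [HasInitial C] [HasStrictInitialObjects C]

lemma isPushout_initial_of_isPullback (hC : Diexact C) {A B D A' B' X : C} {i : A ⟶ D} {j : B ⟶ D}
    (h : IsPushout (initial.to A) (initial.to B) i j) {p : X ⟶ D} {a : A' ⟶ X} {b : B' ⟶ X}
    {αA : A' ⟶ A} {αB : B' ⟶ B} (ha : IsPullback a αA p i) (hb : IsPullback b αB p j) :
    IsPushout (initial.to A') (initial.to B') a b :=
  ((hC _ _ (isMalcevSpan_initial A B)).2 i j h).1 _ _ a b (𝟙 _) αA αB p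
    (isPullback_of_isInitial (Subsingleton.elim _ _) initialIsInitial)
    (isPullback_of_isInitial (Subsingleton.elim _ _) initialIsInitial) ha hb
    (Subsingleton.elim _ _)

variable [HasPullbacks C]

lemma mono_of_isPushout_initial (hC : Diexact C) {A B D : C} {i : A ⟶ D} {j : B ⟶ D}
    (h : IsPushout (initial.to A) (initial.to B) i j) : Mono i := by
  have hP := hC.isPushout_initial_of_isPullback h (.of_hasPullback i i) (.of_hasPullback i j)
  have hd := ((hC _ _ (isMalcevSpan_initial A B)).2 i j h).2
  have : IsIso (initial.to (pullback i j)) := by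
    have := initialIsInitial.isIso_to (hd.lift _ _ (pullback.condition (f := i) (g := j)))
    exact (initialIsInitial.uniqueUpToIso (initialIsInitial.ofIso (asIso (hd.lift _ _
      (pullback.condition (f := i) (g := j)))).symm)).isIso_hom
  have := hP.isIso_inl_of_isIso
  exact (IsKernelPair.of_hasPullback i).mono_of_isIso_fst

lemma isPullback_inl (hC : Diexact C) {A B D A' B' D' : C} {i : A ⟶ D} {j : B ⟶ D}
    {i' : A' ⟶ D'} {j' : B' ⟶ D'} (h : IsPushout (initial.to A) (initial.to B) i j)
    (h' : IsPushout (initial.to A') (initial.to B') i' j')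
    {αA : A' ⟶ A} {αB : B' ⟶ B} {p : D' ⟶ D} (wA : αA ≫ i = i' ≫ p) (wB : αB ≫ j = j' ≫ p) :
    IsPullback i' αA p i := by
  have := hC.mono_of_isPushout_initial h
  have := hC.mono_of_isPushout_initial h'
  have hP := hC.isPushout_initial_of_isPullback h' (.of_hasPullback (pullback.fst p i) i')
    (.of_hasPullback (pullback.fst p i) j')
  have hd := ((hC _ _ (isMalcevSpan_initial A B)).2 i j h).2
  have e : pullback (pullback.fst p i) j' ⟶ ⊥_ C :=
    hd.lift (pullback.fst _ _ ≫ pullback.snd p i) (pullback.snd _ _ ≫ αB) (by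
      rw [Category.assoc, ← pullback.condition, pullback.condition_assoc, Category.assoc, wB])
  have : IsIso (initial.to (pullback (pullback.fst p i) j')) := by
    have := initialIsInitial.isIso_to e
    exact (initialIsInitial.uniqueUpToIso (initialIsInitial.ofIso (asIso e).symm)).isIso_hom
  have := hP.isIso_inl_of_isIso
  have key : (inv (pullback.fst (pullback.fst p i) i') ≫ pullback.snd _ _) ≫ i' =
      pullback.fst p i := by
    rw [Category.assoc, ← pullback.condition, IsIso.inv_hom_id_assoc]
  refine ⟨⟨wA.symm⟩, ⟨PullbackCone.IsLimit.mk _ (fun s => pullback.lift s.fst s.snd s.condition ≫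
    inv (pullback.fst (pullback.fst p i) i') ≫ pullback.snd _ _) (fun s => ?_) (fun s => ?_)
    (fun s m hm _ => ?_)⟩⟩
  · rw [Category.assoc, key, pullback.lift_fst]
  · rw [← cancel_mono i, Category.assoc, wA, ← Category.assoc, Category.assoc _ _ i', key,
      pullback.lift_fst, s.condition]
  · rw [← cancel_mono i', hm, Category.assoc, key, pullback.lift_fst]

lemma finitaryExtensive (hC : Diexact C) : FinitaryExtensive C := by
  have : HasBinaryCoproducts C := by
    have : ∀ {A B : C}, HasColimit (pair A B) := fun {A B} => by
      obtain ⟨⟨D, i, j, h⟩, -⟩ := hC _ _ (isMalcevSpan_initial A B)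
      obtain ⟨hc⟩ := nonempty_isColimit_binaryCofan_of_isPushout initialIsInitial h
      exact ⟨⟨_, hc⟩⟩
    exact hasBinaryCoproducts_of_hasColimit_pair C
  have := hasFiniteCoproducts_of_has_binary_and_initial (C := C)
  refine ⟨fun {X Y} c hc => (BinaryCofan.isVanKampen_iff c).2 ?_⟩
  have h : IsPushout (initial.to X) (initial.to Y) c.inl c.inr :=
    .of_is_coproduct hc initialIsInitial
  intro X' Y' c' αX αY f hX hY
  constructor
  · rintro ⟨hc'⟩
    have h' : IsPushout (initial.to X') (initial.to Y') c'.inl c'.inr :=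
      .of_is_coproduct hc' initialIsInitial
    exact ⟨hC.isPullback_inl h h' hX hY, hC.isPullback_inl h.flip h'.flip hY hX⟩
  · rintro ⟨hl, hr⟩
    obtain ⟨hc'⟩ := nonempty_isColimit_binaryCofan_of_isPushout initialIsInitial
      (hC.isPushout_initial_of_isPullback h hl hr)
    exact ⟨IsColimit.ofIsoColimit hc' (isoBinaryCofanMk c').symm⟩

end Coproducts

end Diexact

section Regular

lemma eq_of_isPushout_of_section {E A D : C} {s t : E ⟶ A} {r : A ⟶ E} (hs : r ≫ s = 𝟙 A)
    (ht : r ≫ t = 𝟙 A) {h k : A ⟶ D} (w : s ≫ h = t ≫ k) : h = k := by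
  simpa [reassoc_of% hs, reassoc_of% ht] using r ≫= w

lemma isRegularEpi_of_isPushout {E A D : C} {s t : E ⟶ A} {q : A ⟶ D} (h : IsPushout s t q q) :
    IsRegularEpi q :=
  ⟨⟨{ W := E
      left := s
      right := t
      w := h.w
      isColimit := Cofork.IsColimit.mk _ (fun c => h.desc c.π c.π c.condition) (fun c => by simp)
        (fun c m hm => h.hom_ext (by simpa using hm) (by simpa using hm)) }⟩⟩

lemma isPushout_of_isKernelPair {E A D : C} {s t : E ⟶ A} {q : A ⟶ D} [IsRegularEpi q]
    (h : IsKernelPair q s t) : IsPushout s t q q := by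
  refine .mk' h.w (fun T φ φ' e _ => (cancel_epi q).1 e) (fun T a b e => ?_)
  obtain rfl := eq_of_isPushout_of_section (h.lift_fst (𝟙 A) (𝟙 A) rfl)
    (h.lift_snd (𝟙 A) (𝟙 A) rfl) e
  obtain ⟨l, hl⟩ := IsRegularEpi.exists_of_isKernelPair q h a e
  exact ⟨l, hl, hl⟩

lemma isPullback_of_isKernelPair {X Y W V E E' : C} {f : X ⟶ Y} {g : W ⟶ Y} {a : V ⟶ X}
    {p : V ⟶ W} {s t : E ⟶ X} {s' t' : E' ⟶ V} (sq : IsPullback a p f g)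
    (h : IsKernelPair f s t) (h' : IsKernelPair p s' t') {α : E' ⟶ E}
    (hs : α ≫ s = s' ≫ a) (ht : α ≫ t = t' ≫ a) : IsPullback s' α a s := by
  refine .mk' hs.symm (fun T φ φ' e₁ e₂ => h'.hom_ext e₁ (sq.hom_ext ?_ ?_)) (fun T x y e => ?_)
  · simp only [Category.assoc, ← ht, reassoc_of% e₂]
  · simp only [Category.assoc, ← h'.w, reassoc_of% e₁]
  · obtain ⟨z, hz₁, hz₂⟩ := sq.exists_lift (y ≫ t) (x ≫ p) (by
      simp only [Category.assoc, ← h.w, ← reassoc_of% e, sq.w])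
    obtain ⟨l, hl₁, hl₂⟩ := h'.exists_lift x z hz₂.symm
    refine ⟨l, hl₁, h.hom_ext ?_ ?_⟩
    · simp only [Category.assoc, hs, reassoc_of% hl₁, e]
    · simp only [Category.assoc, ht, reassoc_of% hl₂, hz₁]

lemma Diexact.barrExact [HasFiniteLimits C] (hC : Diexact C) : BarrExact C := by
  refine ⟨fun X Y f => ?_, fun X Y W f g hf => ?_, fun E A s t hst => ?_⟩
  · obtain ⟨⟨D, h, k, hp⟩, -⟩ := hC _ _ (isMalcevSpan_of_isPullback (.of_hasPullback f f))
    obtain rfl := eq_of_isPushout_of_section (pullback.lift_fst (𝟙 X) (𝟙 X) rfl)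
      (pullback.lift_snd (𝟙 X) (𝟙 X) rfl) hp.w
    exact ⟨⟨_, Cofork.IsColimit.mk (Cofork.ofπ h hp.w) (fun c => hp.desc c.π c.π c.condition)
      (fun c => by simp) (fun c m hm => hp.hom_ext (by simpa using hm) (by simpa using hm))⟩⟩
  · have : IsRegularEpi f := ⟨hf⟩
    have hp := isPushout_of_isKernelPair (IsKernelPair.of_hasPullback f)
    have hst := ((hC _ _ (isMalcevSpan_of_isPullback (IsPullback.of_hasPullback f f))).2 f f hp).1
    have sq := IsPullback.of_hasPullback f g
    generalize pullback.snd f g = p at sq ⊢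
    have hf := IsKernelPair.of_hasPullback f
    have hp := IsKernelPair.of_hasPullback p
    obtain ⟨α, hα₁, hα₂⟩ := hf.exists_lift (pullback.fst p p ≫ pullback.fst f g)
      (pullback.snd p p ≫ pullback.fst f g) (by simp only [Category.assoc, sq.w, reassoc_of% hp.w])
    have sq₁ := isPullback_of_isKernelPair sq hf hp hα₁ hα₂
    have sq₂ := isPullback_of_isKernelPair sq hf.flip hp.flip hα₂ hα₁
    exact (isRegularEpi_of_isPushout
      (hst _ _ p p α _ _ g sq₁ sq₂ sq.flip sq.flip hp.w)).regularEpi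
  · obtain ⟨⟨D, h, k, hp⟩, hstab⟩ := hC _ _ hst.isMalcevSpan
    obtain ⟨-, ⟨r, hrs, hrt⟩, -⟩ := hst
    obtain rfl := eq_of_isPushout_of_section hrs hrt hp.w
    exact ⟨D, h, (hstab h h hp).2⟩

end Regular

end DiexactToPretopos

section PretoposToDiexact

variable {C : Type u} [Category.{v} C]

section Locality

lemma FactorsThru.of_isRegularEpi {U' U X N : C} (e : U' ⟶ U) [IsRegularEpi e] {n : N ⟶ X}
    [Mono n] {x : U ⟶ X} (h : FactorsThru (e ≫ x) n) : FactorsThru x n := by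
  obtain ⟨w, hw⟩ := h
  have sq : CommSq w e n x := ⟨hw⟩
  exact ⟨sq.lift, sq.fac_right⟩

lemma factorsThru_equalizer_iff [HasEqualizers C] {V U X : C} (x y : U ⟶ X) (j : V ⟶ U) :
    FactorsThru j (equalizer.ι x y) ↔ j ≫ x = j ≫ y := by
  refine ⟨fun ⟨w, hw⟩ => ?_, fun h => ⟨equalizer.lift j h, equalizer.lift_ι _ _⟩⟩
  rw [← hw, Category.assoc, equalizer.condition, Category.assoc]

variable [FinitaryExtensive C]

lemma factorsThru_of_inl_eq_inr {U A B X N : C} {a : U ⟶ A} {b : U ⟶ B}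
    (h : a ≫ (coprod.inl : A ⟶ A ⨿ B) = b ≫ coprod.inr) (x : U ⟶ X) (n : N ⟶ X) :
    FactorsThru x n := by
  let e : U ⟶ ⊥_ C :=
    (FinitaryExtensive.isPullback_initial_to_binaryCofan (coprodIsCoprod A B)).lift a b h
  have := initialIsInitial.isIso_to e
  exact ⟨e ≫ initial.to _, (initialIsInitial.ofIso (asIso e).symm).hom_ext _ _⟩

lemma nonempty_isColimit_of_isPullback {U A B V W : C} {m : U ⟶ A ⨿ B} {i : V ⟶ U} {j : W ⟶ U}
    {a : V ⟶ A} {b : W ⟶ B} (hi : IsPullback i a m coprod.inl) (hj : IsPullback j b m coprod.inr) :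
    Nonempty (IsColimit (BinaryCofan.mk i j)) :=
  ((BinaryCofan.isVanKampen_iff _).1 (FinitaryExtensive.vanKampen _ (coprodIsCoprod A B))
    (BinaryCofan.mk i j) a b m hi.w.symm hj.w.symm).2 ⟨hi, hj⟩

lemma factorsThru_of_coprod [HasPullbacks C] {U A B X N : C} (m : U ⟶ A ⨿ B) {n : N ⟶ X}
    {x : U ⟶ X}
    (hl : ∀ ⦃V : C⦄ (j : V ⟶ U) (a : V ⟶ A), j ≫ m = a ≫ coprod.inl → FactorsThru (j ≫ x) n)
    (hr : ∀ ⦃V : C⦄ (j : V ⟶ U) (b : V ⟶ B), j ≫ m = b ≫ coprod.inr → FactorsThru (j ≫ x) n) :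
    FactorsThru x n := by
  obtain ⟨hc⟩ := nonempty_isColimit_of_isPullback (.of_hasPullback m coprod.inl)
    (.of_hasPullback m coprod.inr)
  obtain ⟨a, ha⟩ := hl _ _ pullback.condition
  obtain ⟨b, hb⟩ := hr _ _ pullback.condition
  obtain ⟨w, hwa, hwb⟩ := BinaryCofan.IsColimit.desc' hc a b
  exact ⟨w, BinaryCofan.IsColimit.hom_ext hc
    ((Category.assoc _ _ _).symm.trans ((congrArg (· ≫ n) hwa).trans ha))
    ((Category.assoc _ _ _).symm.trans ((congrArg (· ≫ n) hwb).trans hb))⟩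

end Locality

lemma IsMalcevSpan.exists_map [HasPullbacks C] {Z A B U : C} {f : Z ⟶ A} {g : Z ⟶ B}
    (h : IsMalcevSpan f g) (x y z : U ⟶ Z) (hxy : x ≫ g = y ≫ g) (hyz : y ≫ f = z ≫ f) :
    ∃ p : U ⟶ Z, p ≫ f = x ≫ f ∧ p ≫ g = z ≫ g := by
  obtain ⟨p, hpf, hpg⟩ := h.2 (pullback.fst (pullback.snd g g ≫ f) f ≫ pullback.fst g g)
    (pullback.fst (pullback.snd g g ≫ f) f ≫ pullback.snd g g) (pullback.snd _ _)
    { w₁ := by simp only [Category.assoc, pullback.condition]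
      w₂ := by rw [Category.assoc, pullback.condition]
      lift := fun X x₁ x₂ x₃ h₁ h₂ => by
        refine ⟨pullback.lift (pullback.lift x₁ x₂ h₁) x₃ ?_, ⟨?_, ?_, ?_⟩, ?_⟩
        · rw [pullback.lift_snd_assoc, h₂]
        · rw [pullback.lift_fst_assoc, pullback.lift_fst]
        · rw [pullback.lift_fst_assoc, pullback.lift_snd]
        · rw [pullback.lift_snd]
        · rintro u ⟨rfl, rfl, rfl⟩
          apply pullback.hom_ext
          · rw [pullback.lift_fst]
            apply pullback.hom_ext <;> simp [pullback.lift_fst, pullback.lift_snd]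
          · rw [pullback.lift_snd] }
  refine ⟨pullback.lift (pullback.lift x y hxy) z (by rw [pullback.lift_snd_assoc, hyz]) ≫ p,
    ?_, ?_⟩
  · rw [Category.assoc, hpf, Category.assoc, pullback.lift_fst_assoc, pullback.lift_fst_assoc]
  · rw [Category.assoc, hpg, pullback.lift_snd_assoc]

/-- `(s, z)` presents the relation from `A ⨿ B` to `Z` that links `c₂` to `inl (f c₁)` when
`g c₁ = g c₂`, and to `inr (g c₁)` when `f c₁ = f c₂`. -/
structure IsLink [HasBinaryCoproducts C] {Z A B M : C} (f : Z ⟶ A) (g : Z ⟶ B) (s : M ⟶ A ⨿ B)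
    (z : M ⟶ Z) : Prop where
  left : ∀ ⦃U : C⦄ (c₁ c₂ : U ⟶ Z), c₁ ≫ g = c₂ ≫ g →
    ∃ m : U ⟶ M, m ≫ s = c₁ ≫ f ≫ coprod.inl ∧ m ≫ z = c₂
  right : ∀ ⦃U : C⦄ (c₁ c₂ : U ⟶ Z), c₁ ≫ f = c₂ ≫ f →
    ∃ m : U ⟶ M, m ≫ s = c₁ ≫ g ≫ coprod.inr ∧ m ≫ z = c₂
  cases : ∀ ⦃U X N : C⦄ (m : U ⟶ M) (n : N ⟶ X) (x : U ⟶ X),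
    (∀ ⦃V : C⦄ (j : V ⟶ U) (c₁ c₂ : V ⟶ Z), c₁ ≫ g = c₂ ≫ g →
      j ≫ m ≫ s = c₁ ≫ f ≫ coprod.inl → j ≫ m ≫ z = c₂ → FactorsThru (j ≫ x) n) →
    (∀ ⦃V : C⦄ (j : V ⟶ U) (c₁ c₂ : V ⟶ Z), c₁ ≫ f = c₂ ≫ f →
      j ≫ m ≫ s = c₁ ≫ g ≫ coprod.inr → j ≫ m ≫ z = c₂ → FactorsThru (j ≫ x) n) →
    FactorsThru x n

lemma exists_isLink [FinitaryExtensive C] [HasPullbacks C] {Z A B : C} (f : Z ⟶ A) (g : Z ⟶ B) :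
    ∃ (M : C) (s : M ⟶ A ⨿ B) (z : M ⟶ Z), IsLink f g s z := by
  refine ⟨pullback g g ⨿ pullback f f,
    coprod.desc (pullback.fst g g ≫ f ≫ coprod.inl) (pullback.fst f f ≫ g ≫ coprod.inr),
    coprod.desc (pullback.snd g g) (pullback.snd f f), fun U c₁ c₂ h => ?_, fun U c₁ c₂ h => ?_,
    fun U X N m n x hl hr => factorsThru_of_coprod m (fun V j a ha => ?_) fun V j b hb => ?_⟩
  · exact ⟨pullback.lift c₁ c₂ h ≫ coprod.inl,
      by rw [Category.assoc, coprod.inl_desc, pullback.lift_fst_assoc],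
      by rw [Category.assoc, coprod.inl_desc, pullback.lift_snd]⟩
  · exact ⟨pullback.lift c₁ c₂ h ≫ coprod.inr,
      by rw [Category.assoc, coprod.inr_desc, pullback.lift_fst_assoc],
      by rw [Category.assoc, coprod.inr_desc, pullback.lift_snd]⟩
  · exact hl j (a ≫ pullback.fst g g) (a ≫ pullback.snd g g) (by simp [pullback.condition])
      (by rw [reassoc_of% ha, coprod.inl_desc, Category.assoc])
      (by rw [reassoc_of% ha, coprod.inl_desc])
  · exact hr j (b ≫ pullback.fst f f) (b ≫ pullback.snd f f) (by simp [pullback.condition])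
      (by rw [reassoc_of% hb, coprod.inr_desc, Category.assoc])
      (by rw [reassoc_of% hb, coprod.inr_desc])

/-- Links between the sum and the apex of a Mal'cev span satisfy, locally, the Mal'cev condition. -/
lemma IsLink.malcev [FinitaryExtensive C] [HasPullbacks C] {Z A B M : C} {f : Z ⟶ A} {g : Z ⟶ B}
    {s : M ⟶ A ⨿ B} {z : M ⟶ Z} (hM : IsLink f g s z) (hfg : IsMalcevSpan f g) {U X N : C}
    (m₁ m₂ m₃ : U ⟶ M) (h₁₂ : m₁ ≫ z = m₂ ≫ z) (h₂₃ : m₂ ≫ s = m₃ ≫ s) (n : N ⟶ X) (x : U ⟶ X)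
    (hn : ∀ ⦃V : C⦄ (j : V ⟶ U) (m : V ⟶ M), m ≫ s = j ≫ m₁ ≫ s → m ≫ z = j ≫ m₃ ≫ z →
      FactorsThru (j ≫ x) n) : FactorsThru x n := by
  have := FinitaryExtensive.mono_inl_of_isColimit (coprodIsCoprod A B)
  have := FinitaryExtensive.mono_inr_of_isColimit (coprodIsCoprod A B)
  have hn' : ∀ ⦃V W Y : C⦄ (l : Y ⟶ W) (k : W ⟶ V) (j : V ⟶ U) (m : Y ⟶ M),
      m ≫ s = l ≫ k ≫ j ≫ m₁ ≫ s → m ≫ z = l ≫ k ≫ j ≫ m₃ ≫ z →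
      FactorsThru (l ≫ k ≫ j ≫ x) n := by
    intro V W Y l k j m hs hz
    simpa only [Category.assoc] using hn (l ≫ k ≫ j) m (by simpa using hs) (by simpa using hz)
  refine hM.cases m₁ n x (fun V j c₁ c₁' hc hs₁ hz₁ => ?_) fun V j c₁ c₁' hc hs₁ hz₁ => ?_ <;>
  refine hM.cases (j ≫ m₂) n (j ≫ x) (fun W k d₁ d₂ hd hs₂ hz₂ => ?_)
    (fun W k d₁ d₂ hd hs₂ hz₂ => ?_) <;>
  refine hM.cases (k ≫ j ≫ m₃) n (k ≫ j ≫ x) (fun Y l e₁ e₂ he hs₃ hz₃ => ?_)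
    (fun Y l e₁ e₂ he hs₃ hz₃ => ?_) <;>
  simp only [Category.assoc, ← h₂₃] at hs₃ hz₃ hs₂ hz₂ <;>
  rw [← h₁₂, hz₁] at hz₂ <;>
  rw [hs₂] at hs₃
  · have hs₃' : l ≫ d₁ ≫ f = e₁ ≫ f := by
      simpa only [← cancel_mono (coprod.inl : A ⟶ A ⨿ B), Category.assoc] using hs₃
    obtain ⟨p, hpf, hpg⟩ := hfg.exists_map (l ≫ k ≫ c₁) (l ≫ d₁) e₁
      (by simp only [Category.assoc, hc, hd, ← hz₂]) (by simpa only [Category.assoc] using hs₃')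
    obtain ⟨m, hms, hmz⟩ := hM.left p e₂ (hpg.trans he)
    exact hn' l k j m (by rw [hms, reassoc_of% hpf, hs₁])
      (hmz.trans hz₃.symm)
  · exact factorsThru_of_inl_eq_inr (a := l ≫ d₁ ≫ f) (b := e₁ ≫ g) (by simpa using hs₃) _ n
  · exact factorsThru_of_inl_eq_inr (a := e₁ ≫ f) (b := l ≫ d₁ ≫ g) (by simpa using hs₃.symm) _ n
  · have hs₃' : l ≫ d₁ ≫ g = e₁ ≫ g := by
      simpa only [← cancel_mono (coprod.inr : B ⟶ A ⨿ B), Category.assoc] using hs₃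
    obtain ⟨r, hrf, hrg⟩ := hfg.exists_map (l ≫ d₁) e₁ e₂
      (by simpa only [Category.assoc] using hs₃') he
    obtain ⟨p, hpf, hpg⟩ := hfg.exists_map (l ≫ k ≫ c₁) (l ≫ k ≫ c₁') r
      (by simp only [Category.assoc, hc])
      (by simp only [hrf, Category.assoc, hd, ← hz₂])
    obtain ⟨m, hms, hmz⟩ := hM.left p e₂ (hpg.trans hrg)
    exact hn' l k j m (by rw [hms, reassoc_of% hpf, hs₁])
      (hmz.trans hz₃.symm)
  · have hs₃' : l ≫ d₁ ≫ f = e₁ ≫ f := by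
      simpa only [← cancel_mono (coprod.inl : A ⟶ A ⨿ B), Category.assoc] using hs₃
    obtain ⟨r, hrf, hrg⟩ := hfg.exists_map e₂ e₁ (l ≫ d₁) he.symm
      (by simpa only [Category.assoc] using hs₃'.symm)
    obtain ⟨p, hpf, hpg⟩ := hfg.exists_map r (l ≫ k ≫ c₁') (l ≫ k ≫ c₁)
      (by simp only [hrg, Category.assoc, hd, ← hz₂])
      (by simp only [Category.assoc, hc])
    obtain ⟨m, hms, hmz⟩ := hM.right p e₂ (hpf.trans hrf)
    exact hn' l k j m (by rw [hms, reassoc_of% hpg, hs₁])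
      (hmz.trans hz₃.symm)
  · exact factorsThru_of_inl_eq_inr (a := l ≫ d₁ ≫ f) (b := e₁ ≫ g) (by simpa using hs₃) _ n
  · exact factorsThru_of_inl_eq_inr (a := e₁ ≫ f) (b := l ≫ d₁ ≫ g) (by simpa using hs₃.symm) _ n
  · have hs₃' : l ≫ d₁ ≫ g = e₁ ≫ g := by
      simpa only [← cancel_mono (coprod.inr : B ⟶ A ⨿ B), Category.assoc] using hs₃
    obtain ⟨p, hpf, hpg⟩ := hfg.exists_map e₁ (l ≫ d₁) (l ≫ k ≫ c₁)
      (by simpa only [Category.assoc] using hs₃'.symm)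
      (by simp only [Category.assoc, hc, hd, ← hz₂])
    obtain ⟨m, hms, hmz⟩ := hM.right p e₂ (hpf.trans he)
    exact hn' l k j m (by rw [hms, reassoc_of% hpg, hs₁])
      (hmz.trans hz₃.symm)

section Quotient

lemma BarrExact.regular [HasFiniteLimits C] (hC : BarrExact C) : Regular C where
  hasCoequalizer_of_isKernelPair {X Y Z f g₁ g₂} h := by
    have := hC.1 f
    refine hasColimit_of_iso (F := parallelPair (pullback.fst f f) (pullback.snd f f))
      (parallelPair.ext h.isoPullback (Iso.refl _) ?_ ?_)
    · simp
    · simp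
  regularEpiIsStableUnderBaseChange :=
    { of_isPullback := fun {X Y Y' S f g f' g'} sq hg => by
        rw [← (MorphismProperty.regularEpi C).cancel_left_of_respectsIso sq.isoPullback.inv]
        simpa using ⟨hC.2.1 g f hg.regularEpi⟩ }

variable [Regular C] [FinitaryExtensive C]

lemma factorsThru_of_isRegularEpi_coprod {A B E U X N : C} (e : A ⨿ B ⟶ E) [IsRegularEpi e]
    (y : U ⟶ E) {n : N ⟶ X} [Mono n] {x : U ⟶ X}
    (hl : ∀ ⦃V : C⦄ (j : V ⟶ U) (a : V ⟶ A), j ≫ y = a ≫ coprod.inl ≫ e → FactorsThru (j ≫ x) n)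
    (hr : ∀ ⦃V : C⦄ (j : V ⟶ U) (b : V ⟶ B), j ≫ y = b ≫ coprod.inr ≫ e → FactorsThru (j ≫ x) n) :
    FactorsThru x n := by
  refine .of_isRegularEpi (pullback.snd e y) (factorsThru_of_coprod (pullback.fst e y)
    (fun V j a ha => ?_) fun V j b hb => ?_)
  · simpa only [Category.assoc] using hl (j ≫ pullback.snd e y) a
      (by rw [Category.assoc, ← pullback.condition, reassoc_of% ha])
  · simpa only [Category.assoc] using hr (j ≫ pullback.snd e y) b
      (by rw [Category.assoc, ← pullback.condition, reassoc_of% hb])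

/-- In an exact extensive category, a relation that is symmetric and locally transitive has a
quotient, two elements of which agree if and only if they locally are equal or related. -/
lemma exists_quotient
    (hC : ∀ ⦃E A : C⦄ (s t : E ⟶ A), IsEquivRelation s t →
      ∃ (Q : C) (q : A ⟶ Q), IsPullback s t q q)
    {K S : C} (k₁ k₂ : K ⟶ S) (hsymm : ∃ σ : K ⟶ K, σ ≫ k₁ = k₂ ∧ σ ≫ k₂ = k₁)
    (htrans : ∀ ⦃N : C⦄ (n : N ⟶ S ⨯ S) [Mono n],
      (∀ ⦃U : C⦄ (w : U ⟶ K), FactorsThru (prod.lift (w ≫ k₁) (w ≫ k₂)) n) →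
      ∀ ⦃U : C⦄ (x y : U ⟶ K), x ≫ k₂ = y ≫ k₁ → FactorsThru (prod.lift (x ≫ k₁) (y ≫ k₂)) n) :
    ∃ (D : C) (q : S ⟶ D), IsRegularEpi q ∧ k₁ ≫ q = k₂ ≫ q ∧
      ∀ ⦃U : C⦄ (x y : U ⟶ S), x ≫ q = y ≫ q → ∀ ⦃N X : C⦄ (n : N ⟶ X) [Mono n] (u : U ⟶ X),
        (∀ ⦃V : C⦄ (j : V ⟶ U), j ≫ x = j ≫ y → FactorsThru (j ≫ u) n) →
        (∀ ⦃V : C⦄ (j : V ⟶ U) (w : V ⟶ K), j ≫ x = w ≫ k₁ → j ≫ y = w ≫ k₂ →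
          FactorsThru (j ≫ u) n) → FactorsThru u n := by
  obtain ⟨E, e, n, he, hn, hen⟩ : ∃ (E : C) (e : S ⨿ K ⟶ E) (n : E ⟶ S ⨯ S), IsRegularEpi e ∧
      Mono n ∧ e ≫ n = coprod.desc (diag S) (prod.lift k₁ k₂) :=
    let F := Regular.strongEpiMonoFactorisation (coprod.desc (diag S) (prod.lift k₁ k₂))
    ⟨F.I, F.e, F.m, inferInstance, inferInstance, F.fac⟩
  obtain ⟨p, hp⟩ : ∃ p, n ≫ prod.fst = p := ⟨_, rfl⟩
  obtain ⟨p', hp'⟩ : ∃ p', n ≫ prod.snd = p' := ⟨_, rfl⟩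
  have hl : coprod.inl ≫ e ≫ p = 𝟙 S := by
    rw [← hp, reassoc_of% hen, coprod.inl_desc_assoc, prod.lift_fst]
  have hl' : coprod.inl ≫ e ≫ p' = 𝟙 S := by
    rw [← hp', reassoc_of% hen, coprod.inl_desc_assoc, prod.lift_snd]
  have hr : coprod.inr ≫ e ≫ p = k₁ := by
    rw [← hp, reassoc_of% hen, coprod.inr_desc_assoc, prod.lift_fst]
  have hr' : coprod.inr ≫ e ≫ p' = k₂ := by
    rw [← hp', reassoc_of% hen, coprod.inr_desc_assoc, prod.lift_snd]
  have hE {U : C} {a b : U ⟶ S} : FactorsThru (prod.lift a b) n ↔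
      ∃ w : U ⟶ E, w ≫ p = a ∧ w ≫ p' = b := by
    refine exists_congr fun w => ⟨fun h => ?_, fun ⟨ha, hb⟩ => prod.hom_ext ?_ ?_⟩
    · rw [← hp, ← hp', reassoc_of% h, reassoc_of% h, prod.lift_fst, prod.lift_snd]
      exact ⟨rfl, rfl⟩
    · rw [Category.assoc, hp, ha, prod.lift_fst]
    · rw [Category.assoc, hp', hb, prod.lift_snd]
  have hequiv : IsEquivRelation p p' := by
    refine ⟨fun X u v h h' => ?_, ⟨coprod.inl ≫ e, by simpa using hl, by simpa using hl'⟩,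
      hE.1 ?_, hE.1 ?_⟩
    · rw [← cancel_mono n]
      apply prod.hom_ext <;> simpa only [Category.assoc, hp, hp']
    · refine factorsThru_of_isRegularEpi_coprod e (𝟙 E) (fun V j a ha => ?_) fun V j w hw => ?_
      · rw [Category.comp_id] at ha
        rw [prod.comp_lift, hE]
        exact ⟨j, by simp [ha, hl, hl'], by simp [ha, hl, hl']⟩
      · obtain ⟨σ, hσ₁, hσ₂⟩ := hsymm
        rw [Category.comp_id] at hw
        rw [prod.comp_lift, hE]
        exact ⟨w ≫ σ ≫ coprod.inr ≫ e, by simp [hw, hr, hr', hσ₁], by simp [hw, hr, hr', hσ₂]⟩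
    · refine factorsThru_of_isRegularEpi_coprod e (pullback.fst p' p) (fun V j a ha => ?_)
        fun V j w hw => factorsThru_of_isRegularEpi_coprod e (j ≫ pullback.snd p' p)
          (fun V i a ha => ?_) fun V i w' hw' => ?_
      · rw [prod.comp_lift, hE]
        refine ⟨j ≫ pullback.snd _ _, ?_, by simp⟩
        rw [Category.assoc, ← pullback.condition, reassoc_of% ha, reassoc_of% ha, hl, hl']
      · rw [prod.comp_lift, prod.comp_lift, hE]
        refine ⟨i ≫ j ≫ pullback.fst _ _, by simp, ?_⟩
        simp only [Category.assoc] at ha ⊢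
        rw [pullback.condition, reassoc_of% ha, reassoc_of% ha, hl, hl']
      · have := htrans n (fun U w => hE.2 ⟨w ≫ coprod.inr ≫ e, by simp [hr], by simp [hr']⟩)
          (i ≫ w) w' (by
            rw [← hr, ← hr', ← reassoc_of% hw', Category.assoc, ← reassoc_of% hw,
              pullback.condition])
        convert this using 1
        rw [prod.comp_lift, prod.comp_lift, ← hr, ← hr', ← reassoc_of% hw', Category.assoc,
          ← reassoc_of% hw]
  obtain ⟨Q, q₀, hq₀⟩ := hC p p' hequiv
  have := Regular.hasCoequalizer_of_isKernelPair hq₀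
  have hq : IsKernelPair (coequalizer.π p p') p p' :=
    IsKernelPair.cancel_right (f₂ := coequalizer.desc q₀ hq₀.w) (coequalizer.condition p p')
      (by simpa only [coequalizer.π_desc] using hq₀)
  refine ⟨_, coequalizer.π p p', inferInstance, ?_, fun U x y hxy N X n _ u h h' => ?_⟩
  · rw [← hr, ← hr']
    simp only [Category.assoc, hq.w]
  · obtain ⟨z, rfl, rfl⟩ := hq.exists_lift x y hxy
    refine factorsThru_of_isRegularEpi_coprod e z (fun V j a ha => h j ?_)
      fun V j w hw => h' j w ?_ ?_
    · rw [reassoc_of% ha, reassoc_of% ha, hl, hl']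
    · rw [reassoc_of% hw, hr]
    · rw [reassoc_of% hw, hr']

end Quotient

section Pushout

lemma PushoutStable.isPushout {Z A B D : C} {f : Z ⟶ A} {g : Z ⟶ B} {h : A ⟶ D} {k : B ⟶ D}
    (H : PushoutStable f g h k) (w : f ≫ h = g ≫ k) : IsPushout f g h k :=
  H f g h k (𝟙 Z) (𝟙 A) (𝟙 B) (𝟙 D) (.of_vert_isIso ⟨by simp⟩) (.of_vert_isIso ⟨by simp⟩)
    (.of_vert_isIso ⟨by simp⟩) (.of_vert_isIso ⟨by simp⟩) w

lemma PushoutStable.of_iso {Z A B D E : C} {f : Z ⟶ A} {g : Z ⟶ B} {h : A ⟶ D} {k : B ⟶ D}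
    (H : PushoutStable f g h k) (e : D ≅ E) : PushoutStable f g (h ≫ e.hom) (k ≫ e.hom) := by
  intro Z' A' B' D' f' g' h' k' αZ αA αB αD hf hg hh hk w
  have he {X : C} (l : X ⟶ D) : IsPullback (l ≫ e.hom) (𝟙 X) e.inv l := .of_vert_isIso ⟨by simp⟩
  exact H f' g' h' k' αZ αA αB (αD ≫ e.inv) hf hg (by simpa using hh.paste_vert (he h))
    (by simpa using hk.paste_vert (he k)) w

variable [Regular C] [FinitaryExtensive C]

lemma isPullback_of_isLink {Z A B M D : C} {f : Z ⟶ A} {g : Z ⟶ B} {s : M ⟶ A ⨿ B} {z : M ⟶ Z}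
    (hM : IsLink f g s z) (hfg : IsMalcevSpan f g) (q : A ⨿ B ⟶ D)
    (hw : f ≫ coprod.inl ≫ q = g ≫ coprod.inr ≫ q)
    (hq : ∀ ⦃U : C⦄ (x y : U ⟶ A ⨿ B), x ≫ q = y ≫ q → ∀ ⦃N X : C⦄ (n : N ⟶ X) [Mono n]
      (u : U ⟶ X), (∀ ⦃V : C⦄ (j : V ⟶ U), j ≫ x = j ≫ y → FactorsThru (j ≫ u) n) →
      (∀ ⦃V : C⦄ (j : V ⟶ U) (m₁ m₂ : V ⟶ M), j ≫ x = m₁ ≫ s → j ≫ y = m₂ ≫ s →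
        m₁ ≫ z = m₂ ≫ z → FactorsThru (j ≫ u) n) → FactorsThru u n) :
    IsPullback f g (coprod.inl ≫ q) (coprod.inr ≫ q) := by
  have := FinitaryExtensive.mono_inl_of_isColimit (coprodIsCoprod A B)
  have := FinitaryExtensive.mono_inr_of_isColimit (coprodIsCoprod A B)
  have hmono : Mono (prod.lift f g) := ⟨fun u v h => hfg.1 u v
    (by simpa only [Category.assoc, prod.lift_fst] using h =≫ prod.fst)
    (by simpa only [Category.assoc, prod.lift_snd] using h =≫ prod.snd)⟩
  refine .mk' hw (fun T φ φ' e e' => hfg.1 _ _ e e') fun T a b hab => ?_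
  suffices FactorsThru (prod.lift a b) (prod.lift f g) by
    obtain ⟨w, h⟩ := this
    exact ⟨w, by simpa only [Category.assoc, prod.lift_fst] using h =≫ prod.fst,
      by simpa only [Category.assoc, prod.lift_snd] using h =≫ prod.snd⟩
  refine hq (a ≫ coprod.inl) (b ≫ coprod.inr) (by simpa using hab) _ _
    (fun V j h => factorsThru_of_inl_eq_inr (a := j ≫ a) (b := j ≫ b) (by simpa using h) _ _)
    fun V j m₁ m₂ h₁ h₂ hz => ?_
  refine hM.cases m₁ _ _ (fun W i c₁ c₁' hc hs₁ hz₁ => ?_) (fun W i c₁ c₁' hc hs₁ hz₁ =>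
      factorsThru_of_inl_eq_inr (a := i ≫ j ≫ a) (b := c₁ ≫ g) (by simp [h₁, hs₁]) _ _)
  refine hM.cases (i ≫ m₂) _ _ (fun Y l d₁ d₁' hd hs₂ hz₂ =>
      factorsThru_of_inl_eq_inr (a := d₁ ≫ f) (b := l ≫ i ≫ j ≫ b) ?_ _ _)
      (fun Y l d₁ d₁' hd hs₂ hz₂ => ?_)
  · rw [Category.assoc, ← hs₂]
    simp [h₂]
  · rw [← h₁, ← Category.assoc c₁, ← Category.assoc j, ← Category.assoc i, cancel_mono] at hs₁
    simp only [Category.assoc, ← h₂, ← hz] at hs₂ hz₂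
    rw [← Category.assoc d₁, ← Category.assoc j, ← Category.assoc i, ← Category.assoc l,
      cancel_mono] at hs₂
    rw [hz₁] at hz₂
    obtain ⟨p, hpf, hpg⟩ := hfg.exists_map (l ≫ c₁) (l ≫ c₁') d₁ (by simp [hc]) (by simp [hz₂, hd])
    refine ⟨p, prod.hom_ext ?_ ?_⟩
    · simp only [Category.assoc, prod.lift_fst, hpf, hs₁]
    · simp only [Category.assoc, prod.lift_snd, hpg, hs₂]

lemma pushoutStable_of_isLink {Z A B M D : C} {f : Z ⟶ A} {g : Z ⟶ B} {s : M ⟶ A ⨿ B} {z : M ⟶ Z}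
    (hM : IsLink f g s z) (q : A ⨿ B ⟶ D) [IsRegularEpi q]
    (hs : s ≫ q = z ≫ f ≫ coprod.inl ≫ q)
    (hq : ∀ ⦃U : C⦄ (x y : U ⟶ A ⨿ B), x ≫ q = y ≫ q → ∀ ⦃N X : C⦄ (n : N ⟶ X) [Mono n]
      (u : U ⟶ X), (∀ ⦃V : C⦄ (j : V ⟶ U), j ≫ x = j ≫ y → FactorsThru (j ≫ u) n) →
      (∀ ⦃V : C⦄ (j : V ⟶ U) (m₁ m₂ : V ⟶ M), j ≫ x = m₁ ≫ s → j ≫ y = m₂ ≫ s →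
        m₁ ≫ z = m₂ ≫ z → FactorsThru (j ≫ u) n) → FactorsThru u n) :
    PushoutStable f g (coprod.inl ≫ q) (coprod.inr ≫ q) := by
  intro Z' A' B' D' f' g' h' k' αZ αA αB αD hf hg hh hk w
  obtain ⟨P, ρ, τ, hρ, hP⟩ : ∃ (P : C) (ρ : P ⟶ D') (τ : P ⟶ A ⨿ B), IsRegularEpi ρ ∧
      IsPullback ρ τ αD q :=
    ⟨_, pullback.fst αD q, pullback.snd αD q, inferInstance, .of_hasPullback _ _⟩
  obtain ⟨iA, hiA, hiA'⟩ := hP.exists_lift h' (αA ≫ coprod.inl) (by simpa using hh.w)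
  obtain ⟨iB, hiB, hiB'⟩ := hP.exists_lift k' (αB ≫ coprod.inr) (by simpa using hk.w)
  have hA : IsPullback iA αA τ coprod.inl := .of_right (by rwa [hiA]) hiA' hP
  have hB : IsPullback iB αB τ coprod.inr := .of_right (by rwa [hiB]) hiB' hP
  have hZ : IsPullback (f' ≫ h') αZ αD (f ≫ coprod.inl ≫ q) := hf.paste_horiz hh
  obtain ⟨hc⟩ := nonempty_isColimit_of_isPullback hA hB
  refine .mk' w (fun T φ φ' e e' => ?_) fun T a b hab => ?_
  · rw [← cancel_epi ρ]
    refine BinaryCofan.IsColimit.hom_ext hc ?_ ?_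
    · change iA ≫ ρ ≫ φ = iA ≫ ρ ≫ φ'
      rw [reassoc_of% hiA, reassoc_of% hiA, e]
    · change iB ≫ ρ ≫ φ = iB ≫ ρ ≫ φ'
      rw [reassoc_of% hiB, reassoc_of% hiB, e']
  obtain ⟨ψ, hψA, hψB⟩ : ∃ ψ : P ⟶ T, iA ≫ ψ = a ∧ iB ≫ ψ = b :=
    let l := BinaryCofan.IsColimit.desc' hc a b
    ⟨l.1, l.2⟩
  have key {V : C} (σ : V ⟶ P) (m : V ⟶ M) (ζ : V ⟶ Z') (h₁ : σ ≫ τ = m ≫ s)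
      (h₂ : ζ ≫ αZ = m ≫ z) (h₃ : ζ ≫ f' ≫ h' = σ ≫ ρ) : σ ≫ ψ = ζ ≫ f' ≫ a := by
    rw [← Category.id_comp (σ ≫ ψ), ← Category.id_comp (ζ ≫ f' ≫ a), ← factorsThru_equalizer_iff]
    refine hM.cases m _ _ (fun W j c₁ c₂ hc hs₁ hz₁ => ?_) fun W j c₁ c₂ hc hs₁ hz₁ => ?_
    · rw [Category.comp_id, factorsThru_equalizer_iff]
      obtain ⟨a', ha', ha''⟩ := hA.exists_lift (j ≫ σ) (c₁ ≫ f) (by simp [h₁, hs₁])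
      obtain ⟨ζ', hζ', hζ''⟩ := hf.exists_lift a' c₁ ha''
      have hζ : ζ' ≫ g' = j ≫ ζ ≫ g' := hk.hom_ext
        (by simp only [Category.assoc, ← w, h₃, ← reassoc_of% ha', reassoc_of% hζ', hiA])
        (by simp only [Category.assoc, hg.w, reassoc_of% h₂, reassoc_of% hz₁, reassoc_of% hζ'', hc])
      rw [← reassoc_of% ha', hψA, ← hζ', Category.assoc, hab, reassoc_of% hζ]
    · rw [Category.comp_id, factorsThru_equalizer_iff]
      obtain ⟨b', hb', hb''⟩ := hB.exists_lift (j ≫ σ) (c₁ ≫ g) (by simp [h₁, hs₁])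
      obtain ⟨ζ', hζ', hζ''⟩ := hg.exists_lift b' c₁ hb''
      have hζ : ζ' ≫ f' = j ≫ ζ ≫ f' := hh.hom_ext
        (by rw [Category.assoc, Category.assoc, Category.assoc, h₃, w, reassoc_of% hζ', ← hiB,
          reassoc_of% hb'])
        (by simp only [Category.assoc, hf.w, reassoc_of% h₂, reassoc_of% hz₁, reassoc_of% hζ'', hc])
      rw [← reassoc_of% hb', hψB, ← hζ', Category.assoc, ← hab, reassoc_of% hζ]
  have hK := IsKernelPair.of_hasPullback ρ
  obtain ⟨l, hl⟩ := IsRegularEpi.exists_of_isKernelPair ρ hK ψ (by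
    rw [← Category.id_comp (pullback.fst ρ ρ ≫ ψ), ← Category.id_comp (pullback.snd ρ ρ ≫ ψ),
      ← factorsThru_equalizer_iff]
    refine hq (pullback.fst ρ ρ ≫ τ) (pullback.snd ρ ρ ≫ τ)
      (by simp only [Category.assoc, ← hP.w, reassoc_of% hK.w]) _ _ (fun V j h => ?_)
      fun V j m₁ m₂ h₁ h₂ hz => ?_
    · have : j ≫ pullback.fst ρ ρ = j ≫ pullback.snd ρ ρ :=
        hP.hom_ext (by simp only [Category.assoc, hK.w]) (by simpa only [Category.assoc] using h)
      rw [Category.comp_id, factorsThru_equalizer_iff, reassoc_of% this]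
    · rw [Category.comp_id, factorsThru_equalizer_iff]
      obtain ⟨ζ, hζ, hζ'⟩ := hZ.exists_lift (j ≫ pullback.fst ρ ρ ≫ ρ) (m₁ ≫ z) (by
        simp only [Category.assoc, hP.w, reassoc_of% h₁, hs])
      rw [← Category.assoc, ← Category.assoc, key (j ≫ pullback.fst ρ ρ) m₁ ζ (by simpa using h₁)
        hζ' (by simpa using hζ), key (j ≫ pullback.snd ρ ρ) m₂ ζ (by simpa using h₂)
        (hζ'.trans hz) (by simpa [hK.w] using hζ)])
  exact ⟨l, by rw [← hiA, Category.assoc, hl, hψA], by rw [← hiB, Category.assoc, hl, hψB]⟩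

lemma exists_isPushout (hC : ∀ ⦃E A : C⦄ (s t : E ⟶ A), IsEquivRelation s t →
      ∃ (Q : C) (q : A ⟶ Q), IsPullback s t q q) {Z A B : C} {f : Z ⟶ A} {g : Z ⟶ B}
    (hfg : IsMalcevSpan f g) :
    ∃ (D : C) (h : A ⟶ D) (k : B ⟶ D),
      IsPushout f g h k ∧ PushoutStable f g h k ∧ IsPullback f g h k := by
  obtain ⟨M, s, z, hM⟩ := exists_isLink f g
  obtain ⟨D, q, hq, hKq, hq'⟩ := exists_quotient hC (pullback.fst z z ≫ s) (pullback.snd z z ≫ s)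
    ⟨pullback.lift _ _ pullback.condition.symm, by rw [pullback.lift_fst_assoc],
      by rw [pullback.lift_snd_assoc]⟩
    fun N n _ hn U x y hxy => hM.malcev hfg (x ≫ pullback.fst z z) (x ≫ pullback.snd z z)
      (y ≫ pullback.fst z z) (by simp only [Category.assoc, pullback.condition])
      (by simpa only [Category.assoc] using hxy) n _ fun V j m hs hz => by
        convert hn (pullback.lift m (j ≫ y ≫ pullback.snd z z)
          (by simpa only [Category.assoc, pullback.condition] using hz)) using 1
        rw [prod.comp_lift, pullback.lift_fst_assoc, pullback.lift_snd_assoc, hs]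
        simp only [Category.assoc]
  have hKq' {U : C} (m₁ m₂ : U ⟶ M) (h : m₁ ≫ z = m₂ ≫ z) : m₁ ≫ s ≫ q = m₂ ≫ s ≫ q := by
    simpa only [Category.assoc, pullback.lift_fst_assoc, pullback.lift_snd_assoc] using
      pullback.lift m₁ m₂ h ≫= hKq
  have hsl : s ≫ q = z ≫ f ≫ coprod.inl ≫ q := by
    obtain ⟨m, hms, hmz⟩ := hM.left z z rfl
    have := hKq' (𝟙 M) m (by rw [hmz, Category.id_comp])
    rwa [Category.id_comp, reassoc_of% hms] at this
  have hw : f ≫ coprod.inl ≫ q = g ≫ coprod.inr ≫ q := by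
    obtain ⟨m, hms, hmz⟩ := hM.left (𝟙 Z) (𝟙 Z) rfl
    obtain ⟨m', hms', hmz'⟩ := hM.right (𝟙 Z) (𝟙 Z) rfl
    have := hKq' m m' (hmz.trans hmz'.symm)
    rwa [reassoc_of% hms, reassoc_of% hms'] at this
  replace hq' : ∀ ⦃U : C⦄ (x y : U ⟶ A ⨿ B), x ≫ q = y ≫ q → ∀ ⦃N X : C⦄ (n : N ⟶ X) [Mono n]
      (u : U ⟶ X), (∀ ⦃V : C⦄ (j : V ⟶ U), j ≫ x = j ≫ y → FactorsThru (j ≫ u) n) →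
      (∀ ⦃V : C⦄ (j : V ⟶ U) (m₁ m₂ : V ⟶ M), j ≫ x = m₁ ≫ s → j ≫ y = m₂ ≫ s →
        m₁ ≫ z = m₂ ≫ z → FactorsThru (j ≫ u) n) → FactorsThru u n :=
    fun U x y hxy N X n _ u h h' => hq' x y hxy n u h fun V j w hx hy =>
      h' j (w ≫ pullback.fst z z) (w ≫ pullback.snd z z) (by simpa using hx) (by simpa using hy)
        (by simp only [Category.assoc, pullback.condition])
  have hst := pushoutStable_of_isLink hM q hsl hq'
  exact ⟨D, _, _, hst.isPushout hw, hst, isPullback_of_isLink hM hfg q hw hq'⟩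

end Pushout

lemma BarrExact.diexact [HasFiniteLimits C] [FinitaryExtensive C] (hC : BarrExact C) :
    Diexact C := by
  have := hC.regular
  intro Z A B f g hfg
  obtain ⟨D, h, k, hp, hst, hpb⟩ := exists_isPushout hC.2.2 hfg
  refine ⟨⟨D, h, k, hp⟩, fun D' h' k' hp' => ?_⟩
  obtain ⟨e, rfl, rfl⟩ : ∃ e : D ≅ D', h ≫ e.hom = h' ∧ k ≫ e.hom = k' :=
    ⟨hp.isoIsPushout _ _ hp', by simp, by simp⟩
  exact ⟨hst.of_iso e, .mk' hp'.w (fun _ _ _ h₁ h₂ => hpb.hom_ext h₁ h₂)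
    fun T a b hab => hpb.exists_lift a b ((cancel_mono e.hom).1 (by simpa using hab))⟩

end PretoposToDiexact

/-- A finitely complete category is a pretopos (i.e. extensive and
Barr-exact) if and only if it is diexact and has a strict initial object. -/
theorem pretopos_iff_diexact_strictInitial {C : Type u} [Category.{v} C]
    [HasFiniteLimits C] :
    (FinitaryExtensive C ∧ BarrExact C) ↔
      (Diexact C ∧ HasInitial C ∧ HasStrictInitialObjects C) := by
  refine ⟨fun ⟨_, hB⟩ => ⟨hB.diexact, inferInstance, inferInstance⟩, fun ⟨hC, _, _⟩ => ?_⟩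
  exact ⟨hC.finitaryExtensive, hC.barrExact⟩
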